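/- Let N ≥ 2, let Ω ⊂ ℝ^N be a bounded domain, let c₊, c₋, h : cl(Ω) → ℝ be continuous with c₊ ≥ 0, c₋ ≥ 0 and c₊·c₋ ≡ 0 on Ω, let μ : Ω → ℝ be continuous and bounded, and set Ω₊ := closure of {x ∈ Ω : c₊(x) ≠ 0}, assumed nonempty. Suppose there exist λ̃ ∈ ℝ and a classical solution ũ of (P_{λ̃}), and set M := 2·sup_{cl(Ω)} |ũ|. Then for every λ ∈ ℝ, every classical solution u of (P_λ) satisfies −sup_{Ω₊} u⁻ − M ≤ u(x) ≤ sup_{Ω₊} u⁺ + M for all x ∈ Ω, where u⁺ = max(u,0) and u⁻ = max(−u,0). -/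

import Mathlib

open MeasureTheory Metric Set

/-- The Laplacian of a real-valued function on `ℝ^N`, as the sum of second
partial derivatives in the coordinate directions. -/
noncomputable def lap {N : ℕ} (u : EuclideanSpace ℝ (Fin N) → ℝ)
    (x : EuclideanSpace ℝ (Fin N)) : ℝ :=
  ∑ i : Fin N, fderiv ℝ (fun y => fderiv ℝ u y (EuclideanSpace.single i 1)) x
    (EuclideanSpace.single i 1)

/-- `u` is a classical solution of `(P_lam)` on `Ω`. -/
def IsClassicalSolution {N : ℕ} (Ω : Set (EuclideanSpace ℝ (Fin N)))
    (cp cm h μ : EuclideanSpace ℝ (Fin N) → ℝ) (lam : ℝ)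
    (u : EuclideanSpace ℝ (Fin N) → ℝ) : Prop :=
  ContDiffOn ℝ 2 u Ω ∧ ContinuousOn u (closure Ω) ∧
    (∃ C : ℝ, ∀ x ∈ closure Ω, |u x| ≤ C) ∧
    (∀ x ∈ frontier Ω, u x = 0) ∧
    ∀ x ∈ Ω, -lap u x = (lam * cp x - cm x) * u x + μ x * ‖gradient u x‖ ^ 2 + h x

theorem ContDiffAt.differentiableAt_fderiv_apply {E : Type*} [NormedAddCommGroup E]
    [NormedSpace ℝ E] {f : E → ℝ} {x : E} (hf : ContDiffAt ℝ 2 f x) (e : E) :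
    DifferentiableAt ℝ (fun y => fderiv ℝ f y e) x :=
  ((hf.fderiv_right (m := 1) (by norm_num)).differentiableAt (by simp)).clm_apply
    (differentiableAt_const e)

open Filter Topology in
/-- Second-order necessary condition at a local maximum, in a fixed direction. -/
theorem fderiv_fderiv_nonpos_of_isLocalMax {E : Type*} [NormedAddCommGroup E] [NormedSpace ℝ E]
    {f : E → ℝ} {x : E} (hf : ContDiffAt ℝ 2 f x) (hmax : IsLocalMax f x) (e : E) :
    fderiv ℝ (fun y => fderiv ℝ f y e) x e ≤ 0 := by
  by_contra! hpos
  have hline : ∀ t : ℝ, HasDerivAt (fun t : ℝ => x + t • e) e t := fun t => by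
    simpa using ((hasDerivAt_id t).smul_const e).const_add x
  have hcont : Tendsto (fun t : ℝ => x + t • e) (𝓝 0) (𝓝 x) := by
    have := (hline 0).continuousAt.tendsto
    simpa using this
  have hdiff : ∀ᶠ y in 𝓝 x, DifferentiableAt ℝ f y :=
    (hf.eventually (by simp)).mono fun y hy => hy.differentiableAt (by simp)
  have hderiv : deriv (fun t : ℝ => f (x + t • e)) =ᶠ[𝓝 0]
      fun t => fderiv ℝ f (x + t • e) e := by
    filter_upwards [hcont.eventually hdiff] with t ht
    exact (ht.hasFDerivAt.comp_hasDerivAt t (hline t)).deriv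
  have hdiff' : DifferentiableAt ℝ (fun y => fderiv ℝ f y e) (x + (0 : ℝ) • e) := by
    simpa using hf.differentiableAt_fderiv_apply e
  have hsecond : deriv (deriv (fun t : ℝ => f (x + t • e))) 0 =
      fderiv ℝ (fun y => fderiv ℝ f y e) x e := by
    rw [hderiv.deriv_eq]
    simpa [Function.comp_def] using (hdiff'.hasFDerivAt.comp_hasDerivAt 0 (hline 0)).deriv
  have hmax' : IsLocalMax (fun t : ℝ => f (x + t • e)) 0 := by
    have := hcont.eventually hmax
    simpa [IsLocalMax, IsMaxFilter] using this
  have hmin : IsLocalMin (fun t : ℝ => f (x + t • e)) 0 := by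
    refine isLocalMin_of_deriv_deriv_pos (hsecond ▸ hpos) hmax'.deriv_eq_zero ?_
    have h0 : ContinuousAt f (x + (0 : ℝ) • e) := by simpa using hf.continuousAt
    exact ContinuousAt.comp (f := fun t : ℝ => x + t • e) h0 (hline 0).continuousAt
  have hconst : (fun t : ℝ => f (x + t • e)) =ᶠ[𝓝 0] fun _ => f (x + (0 : ℝ) • e) := by
    filter_upwards [hmax', hmin] with t h1 h2
    exact le_antisymm h1 h2
  have : deriv (deriv (fun t : ℝ => f (x + t • e))) 0 = 0 := by
    rw [hconst.deriv.deriv_eq]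
    simp
  linarith

theorem lap_nonpos_of_isLocalMax {N : ℕ} {f : EuclideanSpace ℝ (Fin N) → ℝ}
    {x : EuclideanSpace ℝ (Fin N)} (hf : ContDiffAt ℝ 2 f x) (hmax : IsLocalMax f x) :
    lap f x ≤ 0 :=
  Finset.sum_nonpos fun _ _ => fderiv_fderiv_nonpos_of_isLocalMax hf hmax _

theorem lap_sub {N : ℕ} {f g : EuclideanSpace ℝ (Fin N) → ℝ} {x : EuclideanSpace ℝ (Fin N)}
    (hf : ContDiffAt ℝ 2 f x) (hg : ContDiffAt ℝ 2 g x) :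
    lap (fun y => f y - g y) x = lap f x - lap g x := by
  unfold lap
  rw [← Finset.sum_sub_distrib]
  refine Finset.sum_congr rfl fun i _ => ?_
  have heq : (fun y => fderiv ℝ (fun z => f z - g z) y (EuclideanSpace.single i 1))
      =ᶠ[nhds x] fun y => fderiv ℝ f y (EuclideanSpace.single i 1) -
        fderiv ℝ g y (EuclideanSpace.single i 1) := by
    filter_upwards [hf.eventually (by simp), hg.eventually (by simp)] with y h1 h2
    rw [fderiv_fun_sub (h1.differentiableAt (by simp)) (h2.differentiableAt (by simp))]
    rfl
  rw [heq.fderiv_eq, fderiv_fun_sub (hf.differentiableAt_fderiv_apply _)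
    (hg.differentiableAt_fderiv_apply _)]
  rfl

theorem hasFDerivAt_const_mul_exp_coord {N : ℕ} (i : Fin N) (δ α : ℝ)
    (x : EuclideanSpace ℝ (Fin N)) :
    HasFDerivAt (fun y : EuclideanSpace ℝ (Fin N) => δ * Real.exp (α * y i))
      ((δ * α * Real.exp (α * x i)) • (EuclideanSpace.proj i : _ →L[ℝ] ℝ)) x := by
  have h1 : HasFDerivAt (fun y : EuclideanSpace ℝ (Fin N) => y i)
      (EuclideanSpace.proj i : _ →L[ℝ] ℝ) x :=
    (EuclideanSpace.proj i : EuclideanSpace ℝ (Fin N) →L[ℝ] ℝ).hasFDerivAt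
  have h2 := (h1.const_mul α).exp.const_mul δ
  rwa [smul_smul, smul_smul,
    show δ * Real.exp (α * x i) * α = δ * α * Real.exp (α * x i) by ring] at h2

theorem lap_const_mul_exp_coord {N : ℕ} (i : Fin N) (δ α : ℝ) (x : EuclideanSpace ℝ (Fin N)) :
    lap (fun y => δ * Real.exp (α * y i)) x = δ * α ^ 2 * Real.exp (α * x i) := by
  unfold lap
  rw [Finset.sum_eq_single i]
  · have : (fun y : EuclideanSpace ℝ (Fin N) =>
        fderiv ℝ (fun z : EuclideanSpace ℝ (Fin N) => δ * Real.exp (α * z i)) y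
          (EuclideanSpace.single i 1)) = fun y => (δ * α) * Real.exp (α * y i) := by
      ext y
      simp [(hasFDerivAt_const_mul_exp_coord i δ α y).fderiv]
    rw [this, (hasFDerivAt_const_mul_exp_coord i (δ * α) α x).fderiv]
    simp
    ring
  · intro j _ hj
    have : (fun y : EuclideanSpace ℝ (Fin N) =>
        fderiv ℝ (fun z : EuclideanSpace ℝ (Fin N) => δ * Real.exp (α * z i)) y
          (EuclideanSpace.single j 1)) = fun y => 0 := by
      ext y
      simp [(hasFDerivAt_const_mul_exp_coord i δ α y).fderiv, hj.symm]
    rw [this]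
    simp
  · simp

theorem norm_fderiv_const_mul_exp_coord_le {N : ℕ} (i : Fin N) {δ α : ℝ} (hδ : 0 ≤ δ)
    (hα : 0 ≤ α) (x : EuclideanSpace ℝ (Fin N)) :
    ‖fderiv ℝ (fun y : EuclideanSpace ℝ (Fin N) => δ * Real.exp (α * y i)) x‖ ≤
      δ * α * Real.exp (α * x i) := by
  rw [(hasFDerivAt_const_mul_exp_coord i δ α x).fderiv]
  refine ContinuousLinearMap.opNorm_le_bound _ (by positivity) fun y => ?_
  have hy : ‖y i‖ ≤ ‖y‖ := PiLp.norm_apply_le y i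
  simp only [smul_apply, PiLp.proj_apply, smul_eq_mul, norm_mul,
    Real.norm_eq_abs, Real.abs_exp, abs_of_nonneg hδ, abs_of_nonneg hα] at hy ⊢
  gcongr

/-- Comparison principle for `-Δu = -c u + μ |∇u|² + h` with `c ≥ 0`. -/
theorem sub_le_of_lap_eq {N : ℕ} (hN : 0 < N) {D : Set (EuclideanSpace ℝ (Fin N))}
    (hDo : IsOpen D) (hDb : Bornology.IsBounded D) {c h μ v w : EuclideanSpace ℝ (Fin N) → ℝ}
    (hc : ∀ x ∈ D, 0 ≤ c x) {C : ℝ} (hμ : ∀ x ∈ D, |μ x| ≤ C)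
    (hv : ContDiffOn ℝ 2 v D) (hw : ContDiffOn ℝ 2 w D)
    (hvc : ContinuousOn v (closure D)) (hwc : ContinuousOn w (closure D))
    (hve : ∀ x ∈ D, -lap v x = -c x * v x + μ x * ‖gradient v x‖ ^ 2 + h x)
    (hwe : ∀ x ∈ D, -lap w x = -c x * w x + μ x * ‖gradient w x‖ ^ 2 + h x)
    {k : ℝ} (hk : 0 ≤ k) (hbd : ∀ x ∈ closure D \ D, v x - w x ≤ k) :
    ∀ x ∈ D, v x - w x ≤ k := by
  intro z hz
  by_contra! hzk
  obtain ⟨ε, hε, hzε⟩ : ∃ ε > 0, v z - w z = k + 2 * ε :=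
    ⟨(v z - w z - k) / 2, by linarith, by ring⟩
  have hvwc : ContinuousOn (fun x => v x - w x) (closure D) := hvc.sub hwc
  let K : Set (EuclideanSpace ℝ (Fin N)) := closure D ∩ (fun x => v x - w x) ⁻¹' Ici (k + ε)
  have hK : IsCompact K :=
    hDb.isCompact_closure.of_isClosed_subset
      (hvwc.preimage_isClosed_of_isClosed isClosed_closure isClosed_Ici) inter_subset_left
  have hKD : K ⊆ D := by
    intro x hx
    by_contra hxD
    have h1 := hbd x ⟨hx.1, hxD⟩
    have h2 : k + ε ≤ v x - w x := hx.2
    linarith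
  have hzK : z ∈ K := ⟨subset_closure hz, show k + ε ≤ v z - w z by linarith⟩
  have hgc : ∀ {f : EuclideanSpace ℝ (Fin N) → ℝ}, ContDiffOn ℝ 2 f D →
      ∃ B, ∀ x ∈ K, ‖fderiv ℝ f x‖ ≤ B := fun hf =>
    hK.exists_bound_of_continuousOn
      ((hf.continuousOn_fderiv_of_isOpen hDo (by norm_num)).mono hKD)
  obtain ⟨B₁, hB₁⟩ := hgc hv
  obtain ⟨B₂, hB₂⟩ := hgc hw
  have hC : 0 ≤ C := (abs_nonneg _).trans (hμ z hz)
  have hB₁0 : 0 ≤ B₁ := (norm_nonneg _).trans (hB₁ z hzK)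
  have hB₂0 : 0 ≤ B₂ := (norm_nonneg _).trans (hB₂ z hzK)
  set α : ℝ := C * (B₁ + B₂) + 1 with hα
  have hαpos : 0 < α := by positivity
  let i : Fin N := ⟨0, hN⟩
  have hexp : Continuous fun x : EuclideanSpace ℝ (Fin N) => Real.exp (α * x i) := by fun_prop
  obtain ⟨A, hA⟩ := hK.exists_bound_of_continuousOn hexp.continuousOn
  have hA0 : 0 < A := by
    have := hA z hzK
    rw [Real.norm_eq_abs, Real.abs_exp] at this
    exact (Real.exp_pos _).trans_le this
  set δ : ℝ := ε / A with hδ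
  have hδpos : 0 < δ := by positivity
  have hδA : δ * A = ε := by rw [hδ]; field_simp
  set ψ : EuclideanSpace ℝ (Fin N) → ℝ := fun y => -δ * Real.exp (α * y i) with hψ
  have hψd : ContDiff ℝ 2 ψ := by
    rw [hψ]
    fun_prop
  obtain ⟨x, hxK, hxmax⟩ := hK.exists_isMaxOn ⟨z, hzK⟩
    (f := fun x => (v x - w x) - ψ x) ((hvwc.mono inter_subset_left).sub hψd.continuous.continuousOn)
  have hxD := hKD hxK
  have hEx : δ * Real.exp (α * x i) ≤ ε := by
    have := hA x hxK
    rw [Real.norm_eq_abs, Real.abs_exp] at this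
    rw [← hδA]
    gcongr
  have hEz : 0 < δ * Real.exp (α * z i) := by positivity
  have hxgt : k + ε < v x - w x := by
    have h1 : (v z - w z) - ψ z ≤ (v x - w x) - ψ x := hxmax hzK
    simp only [hψ] at h1
    linarith
  have hDx : D ∈ nhds x := hDo.mem_nhds hxD
  have hvx := hv.contDiffAt hDx
  have hwx := hw.contDiffAt hDx
  have hloc : IsLocalMax (fun x => (v x - w x) - ψ x) x := by
    filter_upwards [hDx, (hvx.sub hwx).continuousAt.eventually (lt_mem_nhds hxgt)] with y hy h2
    exact hxmax ⟨subset_closure hy, le_of_lt h2⟩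
  have hlap := lap_nonpos_of_isLocalMax ((hvx.sub hwx).sub hψd.contDiffAt) hloc
  rw [lap_sub (hvx.sub hwx) hψd.contDiffAt, lap_sub hvx hwx, hψ,
    lap_const_mul_exp_coord] at hlap
  have hgrad : fderiv ℝ v x - fderiv ℝ w x =
      -fderiv ℝ (fun y : EuclideanSpace ℝ (Fin N) => δ * Real.exp (α * y i)) x := by
    have h0 := hloc.fderiv_eq_zero
    rw [fderiv_fun_sub ((hvx.sub hwx).differentiableAt (by simp))
      (hψd.contDiffAt.differentiableAt (by simp)),
      fderiv_fun_sub (hvx.differentiableAt (by simp)) (hwx.differentiableAt (by simp)),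
      sub_eq_zero, hψ, (hasFDerivAt_const_mul_exp_coord i (-δ) α x).fderiv] at h0
    rw [h0, (hasFDerivAt_const_mul_exp_coord i δ α x).fderiv, ← neg_smul]
    ring_nf
  have hnorm : ‖fderiv ℝ v x - fderiv ℝ w x‖ ≤ δ * α * Real.exp (α * x i) := by
    rw [hgrad, norm_neg]
    exact norm_fderiv_const_mul_exp_coord_le i hδpos.le hαpos.le x
  have hsq : |μ x * (‖fderiv ℝ v x‖ ^ 2 - ‖fderiv ℝ w x‖ ^ 2)| ≤
      C * ((B₁ + B₂) * (δ * α * Real.exp (α * x i))) := by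
    rw [sq_sub_sq, abs_mul, abs_mul,
      abs_of_nonneg (add_nonneg (norm_nonneg (fderiv ℝ v x)) (norm_nonneg (fderiv ℝ w x)))]
    gcongr
    · exact hμ x hxD
    · exact hB₁ x hxK
    · exact hB₂ x hxK
    · exact (abs_norm_sub_norm_le _ _).trans hnorm
  have hv' := hve x hxD
  have hw' := hwe x hxD
  simp only [gradient, LinearIsometryEquiv.norm_map] at hv' hw'
  have hcv : 0 ≤ c x * (v x - w x) := mul_nonneg (hc x hxD) (by linarith)
  have hpos : 0 < δ * α * Real.exp (α * x i) := by positivity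
  have hαs : δ * α ^ 2 * Real.exp (α * x i) =
      C * ((B₁ + B₂) * (δ * α * Real.exp (α * x i))) + δ * α * Real.exp (α * x i) := by
    linear_combination (δ * α * Real.exp (α * x i)) * hα
  have := neg_abs_le (μ x * (‖fderiv ℝ v x‖ ^ 2 - ‖fderiv ℝ w x‖ ^ 2))
  have := le_abs_self (μ x * (‖fderiv ℝ v x‖ ^ 2 - ‖fderiv ℝ w x‖ ^ 2))
  linarith

/-- Reduction of the a priori bound to a bound on `Ω₊` (Lemma 4.1): with
`M := 2 sup_{cl Ω} |ũ|` for a solution `ũ` of `(P_λ̃)`, every solution `u` of any `(P_λ)`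
satisfies `-sup_{Ω₊} u⁻ - M ≤ u ≤ sup_{Ω₊} u⁺ + M` on `Ω`. -/
theorem stmt_1 {N : ℕ} (hN : 2 ≤ N) (Ω : Set (EuclideanSpace ℝ (Fin N)))
    (hΩo : IsOpen Ω) (hΩc : IsConnected Ω) (hΩb : Bornology.IsBounded Ω)
    (cp cm h μ : EuclideanSpace ℝ (Fin N) → ℝ)
    (hcpc : ContinuousOn cp (closure Ω)) (hcmc : ContinuousOn cm (closure Ω))
    (hhc : ContinuousOn h (closure Ω)) (hμc : ContinuousOn μ Ω)
    (hμb : ∃ C : ℝ, ∀ x ∈ Ω, |μ x| ≤ C)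
    (hcp0 : ∀ x ∈ Ω, 0 ≤ cp x) (hcm0 : ∀ x ∈ Ω, 0 ≤ cm x)
    (hprod : ∀ x ∈ Ω, cp x * cm x = 0)
    (Ωp : Set (EuclideanSpace ℝ (Fin N))) (hΩp : Ωp = closure {x ∈ Ω | cp x ≠ 0})
    (hne : Ωp.Nonempty)
    (lamt : ℝ) (ut : EuclideanSpace ℝ (Fin N) → ℝ)
    (hut : IsClassicalSolution Ω cp cm h μ lamt ut)
    (M : ℝ) (hM : M = 2 * sSup ((fun x => |ut x|) '' closure Ω)) :
    ∀ lam : ℝ, ∀ u : EuclideanSpace ℝ (Fin N) → ℝ,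
      IsClassicalSolution Ω cp cm h μ lam u →
      ∀ x ∈ Ω,
        -sSup ((fun y => max (-u y) 0) '' Ωp) - M ≤ u x ∧
          u x ≤ sSup ((fun y => max (u y) 0) '' Ωp) + M := by
  have key : ∀ {l₁ l₂ : ℝ} {v w : EuclideanSpace ℝ (Fin N) → ℝ},
      IsClassicalSolution Ω cp cm h μ l₁ v → IsClassicalSolution Ω cp cm h μ l₂ w →
      ∀ {k : ℝ}, 0 ≤ k → (∀ x ∈ Ωp, v x - w x ≤ k) → ∀ x ∈ Ω, v x - w x ≤ k := by
    intro l₁ l₂ v w hv hw k hk hΩpk x hx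
    by_cases hxp : x ∈ Ωp
    · exact hΩpk x hxp
    obtain ⟨C, hC⟩ := hμb
    have hD : Ω \ Ωp ⊆ Ω := sdiff_subset
    have hcp : ∀ y ∈ Ω \ Ωp, cp y = 0 := by
      intro y hy
      by_contra hne0
      exact hy.2 (hΩp ▸ subset_closure ⟨hy.1, hne0⟩)
    have hΩpc : IsClosed Ωp := hΩp ▸ isClosed_closure
    refine sub_le_of_lap_eq (by omega) (hΩo.sdiff hΩpc) (hΩb.subset hD)
      (c := cm) (h := h) (μ := μ) (fun y hy => hcm0 y (hD hy)) (fun y hy => hC y (hD hy))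
      (hv.1.mono hD) (hw.1.mono hD) (hv.2.1.mono (closure_mono hD))
      (hw.2.1.mono (closure_mono hD)) ?_ ?_ hk ?_ x ⟨hx, hxp⟩
    · intro y hy
      rw [hv.2.2.2.2 y (hD hy), hcp y hy]
      ring
    · intro y hy
      rw [hw.2.2.2.2 y (hD hy), hcp y hy]
      ring
    · rintro y ⟨hy, hyD⟩
      by_cases hyp : y ∈ Ωp
      · exact hΩpk y hyp
      have hyf : y ∈ frontier Ω := by
        rw [hΩo.frontier_eq]
        exact ⟨closure_mono hD hy, fun hyΩ => hyD ⟨hyΩ, hyp⟩⟩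
      rw [hv.2.2.2.1 y hyf, hw.2.2.2.1 y hyf]
      simpa using hk
  intro lam u hu x hx
  have hΩpsub : Ωp ⊆ closure Ω := hΩp ▸ closure_mono (sep_subset _ _)
  obtain ⟨Ct, hCt⟩ := hut.2.2.1
  obtain ⟨Cu, hCu⟩ := hu.2.2.1
  have ht : ∀ y ∈ closure Ω, |ut y| ≤ sSup ((fun x => |ut x|) '' closure Ω) := fun y hy =>
    le_csSup ⟨Ct, forall_mem_image.2 hCt⟩ (mem_image_of_mem _ hy)
  have hpos : ∀ y ∈ Ωp, max (u y) 0 ≤ sSup ((fun y => max (u y) 0) '' Ωp) := fun y hy =>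
    le_csSup ⟨Cu, forall_mem_image.2 fun a ha =>
      max_le ((le_abs_self _).trans (hCu a (hΩpsub ha)))
        ((abs_nonneg _).trans (hCu a (hΩpsub ha)))⟩
      (mem_image_of_mem (fun y => max (u y) 0) hy)
  have hneg : ∀ y ∈ Ωp, max (-u y) 0 ≤ sSup ((fun y => max (-u y) 0) '' Ωp) := fun y hy =>
    le_csSup ⟨Cu, forall_mem_image.2 fun a ha =>
      max_le ((neg_le_abs _).trans (hCu a (hΩpsub ha)))
        ((abs_nonneg _).trans (hCu a (hΩpsub ha)))⟩
      (mem_image_of_mem (fun y => max (-u y) 0) hy)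
  obtain ⟨p, hp⟩ := hne
  have hp1 := (le_max_right _ _).trans (hpos p hp)
  have hp2 := (le_max_right _ _).trans (hneg p hp)
  have hp3 := (abs_nonneg _).trans (ht p (hΩpsub hp))
  have hup := key hu hut (add_nonneg hp1 hp3) (fun y hy => by
    have h1 := (le_max_left _ _).trans (hpos y hy)
    have h2 := (neg_le_abs _).trans (ht y (hΩpsub hy))
    linarith) x hx
  have hlo := key hut hu (add_nonneg hp2 hp3) (fun y hy => by
    have h1 := (le_max_left _ _).trans (hneg y hy)
    have h2 := (le_abs_self _).trans (ht y (hΩpsub hy))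
    linarith) x hx
  have hx1 := abs_le.1 (ht x (subset_closure hx))
  constructor <;> linarith [hx1.1, hx1.2]
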